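/- Let X be a uniformly convex (real) Banach space and let A_1,…,A_p (p ≥ 2, indices modulo p) be nonempty, closed and convex subsets of X with common distance D := d(A_i, A_{i+1}) for all i. Let T : ⋃_i A_i → ⋃_i A_i satisfy T(A_i) ⊆ A_{i+1} for all i and ‖Tx − Ty‖ ≤ K·‖x − y‖ + (1−K)·D for all x ∈ A_i, y ∈ A_{i+1} and all i, where K ∈ [0,1). Then for each i and each x ∈ A_i, the sequence (T^{np} x)_{n≥0} converges to a point z_i ∈ A_i satisfying ‖z_i − T z_i‖ = D, the sequence (T^{np+1} x)_{n≥0} converges to z_{i+1} := T z_i ∈ A_{i+1} which also satisfies ‖z_{i+1} − T z_{i+1}‖ = D, and z_i is the unique point of A_i with T^p z_i = z_i; in particular the limiting set (z_1, z_2, …, z_p) of best proximity points is unique and independent of the initial point x ∈ A_i. -/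

import Mathlib

open Filter

/-- The inf distance between two sets of a normed space, via the norm metric. -/
noncomputable def setDist {X : Type*} [NormedAddCommGroup X] (A B : Set X) : ℝ :=
  sInf (Set.image2 (fun a b => ‖a - b‖) A B)

/-- In a uniformly convex space, two almost minimal vectors whose midpoint has at least the minimal
norm are close. -/
theorem exists_forall_norm_sub_lt_of_two_mul_le_norm_add (X : Type*) [NormedAddCommGroup X]
    [NormedSpace ℝ X] [UniformConvexSpace X] {D ε : ℝ} (hD : 0 ≤ D) (hε : 0 < ε) :
    ∃ η > 0, ∀ a b : X, ‖a‖ ≤ D + η → ‖b‖ ≤ D + η → 2 * D ≤ ‖a + b‖ → ‖a - b‖ < ε := by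
  obtain ⟨δ, hδ, h⟩ := exists_forall_closed_ball_dist_add_le_two_mul_sub X (half_pos hε) D
  have hη : 0 < min (ε / 8) (δ / 4) := by positivity
  have hηε : min (ε / 8) (δ / 4) ≤ ε / 8 := min_le_left _ _
  have hηδ : min (ε / 8) (δ / 4) ≤ δ / 4 := min_le_right _ _
  set η := min (ε / 8) (δ / 4)
  refine ⟨η, hη, fun a b ha hb hab => ?_⟩
  have hr : 0 < D + η := by positivity
  have shrink (x : X) (hx : ‖x‖ ≤ D + η) : ∃ y : X, ‖y‖ ≤ D ∧ ‖x - y‖ ≤ η := by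
    refine ⟨(D / (D + η)) • x, ?_, ?_⟩
    · rw [norm_smul_of_nonneg (by positivity), div_mul_eq_mul_div, div_le_iff₀ hr]
      gcongr
    · have hsub : x - (D / (D + η)) • x = (η / (D + η)) • x := by
        rw [show η / (D + η) = 1 - D / (D + η) by field_simp; ring, sub_smul, one_smul]
      rw [hsub, norm_smul_of_nonneg (by positivity), div_mul_eq_mul_div, div_le_iff₀ hr]
      gcongr
  obtain ⟨a', ha', haa'⟩ := shrink a ha
  obtain ⟨b', hb', hbb'⟩ := shrink b hb
  by_contra! hlt
  have h₁ : ‖a - b‖ ≤ ‖a' - b'‖ + ‖a - a'‖ + ‖b - b'‖ := by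
    rw [show a - b = (a' - b') + (a - a') - (b - b') by abel]
    exact (norm_sub_le _ _).trans (by gcongr; exact norm_add_le _ _)
  have h₂ : ‖a + b‖ ≤ ‖a' + b'‖ + ‖a - a'‖ + ‖b - b'‖ := by
    rw [show a + b = (a' + b') + (a - a') + (b - b') by abel]
    exact norm_add₃_le
  have h₃ := h ha' hb' (by linarith)
  linarith

theorem setDist_nonneg {X : Type*} [NormedAddCommGroup X] (A B : Set X) : 0 ≤ setDist A B :=
  Real.sInf_nonneg (by rintro _ ⟨a, -, b, -, rfl⟩; exact norm_nonneg _)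

theorem setDist_le_norm_sub {X : Type*} [NormedAddCommGroup X] {A B : Set X} {a b : X}
    (ha : a ∈ A) (hb : b ∈ B) : setDist A B ≤ ‖a - b‖ :=
  csInf_le ⟨0, by rintro _ ⟨a, -, b, -, rfl⟩; exact norm_nonneg _⟩ ⟨a, ha, b, hb, rfl⟩

/-- Two points of a convex set that almost realise its distance to a common point of another set
are close. -/
theorem Convex.exists_forall_norm_sub_lt_of_setDist {X : Type*} [NormedAddCommGroup X]
    [NormedSpace ℝ X] [UniformConvexSpace X] {A : Set X} (hA : Convex ℝ A) (B : Set X) {ε : ℝ}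
    (hε : 0 < ε) :
    ∃ η > 0, ∀ a ∈ A, ∀ b ∈ A, ∀ c ∈ B, ‖a - c‖ ≤ setDist A B + η → ‖b - c‖ ≤ setDist A B + η →
      ‖a - b‖ < ε := by
  obtain ⟨η, hη, h⟩ :=
    exists_forall_norm_sub_lt_of_two_mul_le_norm_add X (setDist_nonneg A B) hε
  refine ⟨η, hη, fun a ha b hb c hc hac hbc => ?_⟩
  rw [← sub_sub_sub_cancel_right a b c]
  refine h _ _ hac hbc ?_
  have hmid : (1 / 2 : ℝ) • a + (1 / 2 : ℝ) • b ∈ A :=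
    hA ha hb (by norm_num) (by norm_num) (by norm_num)
  have heq : a - c + (b - c) = (2 : ℝ) • ((1 / 2 : ℝ) • a + (1 / 2 : ℝ) • b - c) := by module
  rw [heq, norm_smul_of_nonneg zero_le_two]
  exact mul_le_mul_of_nonneg_left (setDist_le_norm_sub hmid hc) zero_le_two

theorem Convex.tendsto_sub_of_tendsto_setDist {X ι : Type*} [NormedAddCommGroup X]
    [NormedSpace ℝ X] [UniformConvexSpace X] {A B : Set X} (hA : Convex ℝ A) {l : Filter ι}
    {a b c : ι → X} (ha : ∀ n, a n ∈ A) (hb : ∀ n, b n ∈ A) (hc : ∀ n, c n ∈ B)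
    (hac : Tendsto (fun n => ‖a n - c n‖) l (nhds (setDist A B)))
    (hbc : Tendsto (fun n => ‖b n - c n‖) l (nhds (setDist A B))) :
    Tendsto (fun n => a n - b n) l (nhds 0) := by
  rw [NormedAddGroup.tendsto_nhds_zero]
  intro ε hε
  obtain ⟨η, hη, h⟩ := hA.exists_forall_norm_sub_lt_of_setDist B hε
  filter_upwards [hac.eventually_le_const (lt_add_of_pos_right _ hη),
    hbc.eventually_le_const (lt_add_of_pos_right _ hη)] with n h₁ h₂
  exact h _ (ha n) _ (hb n) _ (hc n) h₁ h₂

theorem mapsTo_iterate_mul_of_cyclic {X : Type*} {p : ℕ} {A : ZMod p → Set X} {T : X → X}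
    (hT : ∀ i : ZMod p, Set.MapsTo T (A i) (A (i + 1))) (n : ℕ) (i : ZMod p) :
    Set.MapsTo T^[n * p] (A i) (A i) := by
  have key (m : ℕ) : Set.MapsTo T^[m] (A i) (A (i + m)) := by
    induction m with
    | zero => simpa using Set.mapsTo_id (A i)
    | succ m ih =>
      rw [Function.iterate_succ', Nat.cast_succ, ← add_assoc]
      exact (hT _).comp ih
  simpa using key (n * p)

section Cyclic

variable {X : Type*} [NormedAddCommGroup X] {p : ℕ} {A : ZMod p → Set X} {D K : ℝ} {T : X → X}

theorem norm_iterate_sub_iterate_le_of_cyclic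
    (hT : ∀ i : ZMod p, Set.MapsTo T (A i) (A (i + 1))) (hK0 : 0 ≤ K)
    (hcontr : ∀ i : ZMod p, ∀ x ∈ A i, ∀ y ∈ A (i + 1),
      ‖T x - T y‖ ≤ K * ‖x - y‖ + (1 - K) * D) (n : ℕ) {i : ZMod p} {u v : X}
    (hu : u ∈ A i) (hv : v ∈ A (i + 1)) :
    ‖T^[n] u - T^[n] v‖ ≤ D + K ^ n * (‖u - v‖ - D) := by
  induction n generalizing i u v with
  | zero => simp
  | succ n ih =>
    rw [Function.iterate_succ_apply, Function.iterate_succ_apply]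
    have h₁ := ih (hT _ hu) (hT _ hv)
    have h₂ := mul_le_mul_of_nonneg_left (hcontr i u hu v hv) (pow_nonneg hK0 n)
    rw [pow_succ]
    linarith

theorem tendsto_norm_iterate_sub_iterate_of_cyclic (hp : p ≠ 0)
    (hD : ∀ i : ZMod p, setDist (A i) (A (i + 1)) = D)
    (hT : ∀ i : ZMod p, Set.MapsTo T (A i) (A (i + 1))) (hK0 : 0 ≤ K) (hK1 : K < 1)
    (hcontr : ∀ i : ZMod p, ∀ x ∈ A i, ∀ y ∈ A (i + 1),
      ‖T x - T y‖ ≤ K * ‖x - y‖ + (1 - K) * D) {i : ZMod p} {u v : X}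
    (hu : u ∈ A i) (hv : v ∈ A (i + 1)) :
    Tendsto (fun n => ‖T^[n * p] u - T^[n * p] v‖) atTop (nhds D) := by
  have hlim : Tendsto (fun n => D + K ^ (n * p) * (‖u - v‖ - D)) atTop (nhds D) := by
    have h := (tendsto_pow_atTop_nhds_zero_of_lt_one hK0 hK1).comp
      (tendsto_id.atTop_mul_const' (Nat.pos_of_ne_zero hp))
    simpa using (h.mul_const (‖u - v‖ - D)).const_add D
  refine tendsto_of_tendsto_of_tendsto_of_le_of_le tendsto_const_nhds hlim (fun n => ?_)
    fun n => norm_iterate_sub_iterate_le_of_cyclic hT hK0 hcontr _ hu hv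
  rw [← hD i]
  exact setDist_le_norm_sub (mapsTo_iterate_mul_of_cyclic hT n i hu)
    (mapsTo_iterate_mul_of_cyclic hT n _ hv)

theorem exists_forall_norm_iterate_mul_sub_le_of_cyclic (hp : p ≠ 0) (hD0 : 0 ≤ D)
    (hT : ∀ i : ZMod p, Set.MapsTo T (A i) (A (i + 1))) (hK0 : 0 ≤ K) (hK1 : K < 1)
    (hcontr : ∀ i : ZMod p, ∀ x ∈ A i, ∀ y ∈ A (i + 1),
      ‖T x - T y‖ ≤ K * ‖x - y‖ + (1 - K) * D) {i : ZMod p} {u v : X}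
    (hu : u ∈ A i) (hv : v ∈ A (i + 1)) :
    ∃ M, ∀ m, ‖T^[m * p] u - v‖ ≤ M := by
  set C := D + ‖T^[p] v - v‖
  refine ⟨max ‖u - v‖ (C / (1 - K)), fun m => ?_⟩
  induction m with
  | zero => simp
  | succ m ih =>
    set M := max ‖u - v‖ (C / (1 - K))
    have hCM : C ≤ M * (1 - K) := (div_le_iff₀ (by linarith)).1 (le_max_right _ _)
    have h₁ := norm_iterate_sub_iterate_le_of_cyclic hT hK0 hcontr p
      (mapsTo_iterate_mul_of_cyclic hT m i hu) hv
    rw [← Function.iterate_add_apply, show p + m * p = (m + 1) * p by ring] at h₁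
    have h₂ : K ^ p * (‖T^[m * p] u - v‖ - D) ≤ K * M := by
      have hKp : K ^ p ≤ K := pow_le_of_le_one hK0 hK1.le hp
      have hM : 0 ≤ M := (norm_nonneg _).trans ih
      calc _ ≤ K ^ p * M := mul_le_mul_of_nonneg_left (by linarith) (pow_nonneg hK0 p)
        _ ≤ K * M := mul_le_mul_of_nonneg_right hKp hM
    have h₃ := norm_sub_le_norm_sub_add_norm_sub (T^[(m + 1) * p] u) (T^[p] v) v
    linarith

theorem cauchySeq_iterate_mul_of_cyclic [NormedSpace ℝ X] [UniformConvexSpace X] (hp : p ≠ 0)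
    (hAcv : ∀ i, Convex ℝ (A i)) (hD : ∀ i : ZMod p, setDist (A i) (A (i + 1)) = D)
    (hT : ∀ i : ZMod p, Set.MapsTo T (A i) (A (i + 1))) (hK0 : 0 ≤ K) (hK1 : K < 1)
    (hcontr : ∀ i : ZMod p, ∀ x ∈ A i, ∀ y ∈ A (i + 1),
      ‖T x - T y‖ ≤ K * ‖x - y‖ + (1 - K) * D) {i : ZMod p} {x : X} (hx : x ∈ A i) :
    CauchySeq fun n => T^[n * p] x := by
  have hD0 : 0 ≤ D := hD i ▸ setDist_nonneg _ _
  obtain ⟨M, hM⟩ := exists_forall_norm_iterate_mul_sub_le_of_cyclic hp hD0 hT hK0 hK1 hcontr hx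
    (hT i hx)
  have hmem (n : ℕ) := mapsTo_iterate_mul_of_cyclic hT n i hx
  have hlim : Tendsto (fun n => K ^ (n * p) * M) atTop (nhds 0) := by
    have h := (tendsto_pow_atTop_nhds_zero_of_lt_one hK0 hK1).comp
      (tendsto_id.atTop_mul_const' (Nat.pos_of_ne_zero hp))
    simpa using h.mul_const M
  rw [Metric.cauchySeq_iff]
  intro ε hε
  obtain ⟨η, hη, h⟩ := (hAcv i).exists_forall_norm_sub_lt_of_setDist (A (i + 1)) hε
  obtain ⟨N, hN⟩ := (hlim.eventually_le_const hη).exists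
  have hclose (m : ℕ) (hm : m ≥ N) : ‖T^[m * p] x - T^[N * p] (T x)‖ ≤ D + η := by
    obtain ⟨k, rfl⟩ := Nat.exists_eq_add_of_le hm
    have h₁ := norm_iterate_sub_iterate_le_of_cyclic hT hK0 hcontr (N * p) (hmem k) (hT i hx)
    rw [← Function.iterate_add_apply, ← add_mul] at h₁
    have h₂ : K ^ (N * p) * (‖T^[k * p] x - T x‖ - D) ≤ K ^ (N * p) * M :=
      mul_le_mul_of_nonneg_left (by linarith [hM k]) (pow_nonneg hK0 _)
    linarith
  refine ⟨N, fun m hm n hn => ?_⟩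
  rw [dist_eq_norm]
  rw [hD i] at h
  exact h _ (hmem m) _ (hmem n) _ (mapsTo_iterate_mul_of_cyclic hT N _ (hT i hx))
    (hclose m hm) (hclose n hn)

end Cyclic

/-- Contractive `p`-cyclic case of Theorem 3.2(i) (see Corollary 3.4 and
Remarks 3.3(2)): in a uniformly convex real Banach space, a contractive
`p`-cyclic self-mapping of the union of nonempty closed convex subsets
`A_1, …, A_p` at common distance `D` has, in each `A_i`, a unique limiting
best proximity point `z_i` (the unique point of `A_i` fixed by `T^p`), with
`T z_i = z_{i+1}` a best proximity point of `A_{i+1}`, and for every starting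
point `x ∈ A_i` the iterates `T^{np} x` converge to `z_i` and `T^{np+1} x`
converge to `T z_i`, independently of `x`. -/
theorem stmt_16 {X : Type*} [NormedAddCommGroup X] [NormedSpace ℝ X]
    [UniformConvexSpace X] [CompleteSpace X]
    {p : ℕ} (hp : 2 ≤ p) (A : ZMod p → Set X)
    (hAne : ∀ i, (A i).Nonempty) (hAcl : ∀ i, IsClosed (A i)) (hAcv : ∀ i, Convex ℝ (A i))
    (D : ℝ) (hD : ∀ i : ZMod p, setDist (A i) (A (i + 1)) = D)
    (T : X → X) (hT : ∀ i : ZMod p, Set.MapsTo T (A i) (A (i + 1)))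
    (K : ℝ) (hK0 : 0 ≤ K) (hK1 : K < 1)
    (hcontr : ∀ i : ZMod p, ∀ x ∈ A i, ∀ y ∈ A (i + 1),
      ‖T x - T y‖ ≤ K * ‖x - y‖ + (1 - K) * D) :
    ∀ i : ZMod p, ∃ z : X, z ∈ A i ∧ ‖z - T z‖ = D ∧
      T z ∈ A (i + 1) ∧ ‖T z - T (T z)‖ = D ∧
      T^[p] z = z ∧ (∀ w ∈ A i, T^[p] w = w → w = z) ∧
      ∀ x ∈ A i,
        Tendsto (fun n => T^[n * p] x) atTop (nhds z) ∧
        Tendsto (fun n => T^[n * p + 1] x) atTop (nhds (T z)) := by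
  have hp0 : p ≠ 0 := by lia
  intro i
  have hdist (j : ZMod p) {u v : X} (hu : u ∈ A j) (hv : v ∈ A (j + 1)) : D ≤ ‖u - v‖ :=
    hD j ▸ setDist_le_norm_sub hu hv
  have hmem (n : ℕ) (j : ZMod p) := mapsTo_iterate_mul_of_cyclic hT n j
  have hnorm (j : ZMod p) {u v : X} (hu : u ∈ A j) (hv : v ∈ A (j + 1)) :=
    tendsto_norm_iterate_sub_iterate_of_cyclic hp0 hD hT hK0 hK1 hcontr hu hv
  have hclose (j : ZMod p) {a b c : ℕ → X} (ha : ∀ n, a n ∈ A j) (hb : ∀ n, b n ∈ A j)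
      (hc : ∀ n, c n ∈ A (j + 1)) (hac : Tendsto (fun n => ‖a n - c n‖) atTop (nhds D))
      (hbc : Tendsto (fun n => ‖b n - c n‖) atTop (nhds D)) :
      Tendsto (fun n => a n - b n) atTop (nhds 0) :=
    (hAcv j).tendsto_sub_of_tendsto_setDist ha hb hc (by rwa [hD j]) (by rwa [hD j])
  obtain ⟨x₀, hx₀⟩ := hAne i
  obtain ⟨z, hz⟩ := cauchySeq_tendsto_of_complete
    (cauchySeq_iterate_mul_of_cyclic hp0 hAcv hD hT hK0 hK1 hcontr hx₀)
  have hzA : z ∈ A i := (hAcl i).mem_of_tendsto hz (.of_forall fun n => hmem n i hx₀)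
  have hconv {x : X} (hx : x ∈ A i) : Tendsto (fun n => T^[n * p] x) atTop (nhds z) := by
    have h := hclose i (fun n => hmem n i hx) (fun n => hmem n i hx₀)
      (fun n => hmem n _ (hT i hx₀)) (hnorm i hx (hT i hx₀)) (hnorm i hx₀ (hT i hx₀))
    simpa using h.add hz
  have hzw {x : X} (hx : x ∈ A i) :
      Tendsto (fun n => ‖z - T^[n * p] (T x)‖) atTop (nhds D) := by
    have hdiff : Tendsto (fun n => ‖z - T^[n * p] x‖) atTop (nhds 0) := by
      simpa using ((hconv hx).const_sub z).norm
    refine tendsto_of_tendsto_of_tendsto_of_le_of_le tendsto_const_nhds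
      (by simpa using hdiff.add (hnorm i hx (hT i hx)))
      (fun n => hdist i hzA (hmem n _ (hT i hx)))
      fun n => norm_sub_le_norm_sub_add_norm_sub _ _ _
  have hconv' {x : X} (hx : x ∈ A i) : Tendsto (fun n => T^[n * p] (T x)) atTop (nhds (T z)) := by
    have hmem' (n : ℕ) := hmem n _ (hT i hx)
    have hlim : Tendsto (fun n => ‖T z - T^[n * p] (T (T x))‖) atTop (nhds D) := by
      refine tendsto_of_tendsto_of_tendsto_of_le_of_le tendsto_const_nhds
        (h := fun n => K * ‖z - T^[n * p] (T x)‖ + (1 - K) * D) ?_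
        (fun n => hdist _ (hT i hzA) (hmem n _ (hT _ (hT i hx)))) fun n => ?_
      · convert ((hzw hx).const_mul K).add_const ((1 - K) * D) using 2
        ring
      · have h := hcontr i z hzA _ (hmem' n)
        rwa [← Function.iterate_succ_apply' T, Function.iterate_succ_apply] at h
    have h := hclose _ hmem' (fun _ => hT i hzA) (fun n => hmem n _ (hT _ (hT i hx)))
      (hnorm _ (hT i hx) (hT _ (hT i hx))) hlim
    simpa using h.add_const (T z)
  have hzTz : ‖z - T z‖ = D :=
    tendsto_nhds_unique ((hconv' hx₀).const_sub z).norm (hzw hx₀)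
  have hfix : T^[p] z = z := by
    have hpz : T^[p] z ∈ A i := by simpa using hmem 1 i hzA
    have hle : ‖T^[p] z - T z‖ ≤ D := by
      have h₁ : Tendsto (fun n => T^[p] (T^[n * p] (T z))) atTop (nhds (T z)) := by
        convert (hconv' hzA).comp (tendsto_add_atTop_nat 1) using 2 with n
        rw [Function.comp_apply, ← Function.iterate_add_apply, add_mul, one_mul, add_comm]
      refine le_of_tendsto_of_tendsto' (h₁.const_sub (T^[p] z)).norm
        (g := fun n => D + K ^ p * (‖z - T^[n * p] (T z)‖ - D)) ?_ fun n =>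
        norm_iterate_sub_iterate_le_of_cyclic hT hK0 hcontr p hzA (hmem n _ (hT i hzA))
      simpa using (((hzw hzA).sub_const D).const_mul (K ^ p)).const_add D
    have heq : ‖T^[p] z - T z‖ = D := hle.antisymm (hdist i hpz (hT i hzA))
    have h := hclose i (a := fun _ => T^[p] z) (b := fun _ => z) (c := fun _ => T z)
      (fun _ => hpz) (fun _ => hzA) (fun _ => hT i hzA) (by simp [heq]) (by simp [hzTz])
    exact sub_eq_zero.1 (tendsto_nhds_unique tendsto_const_nhds h)
  refine ⟨z, hzA, hzTz, hT i hzA, ?_, hfix, fun w hw hwfix => ?_, fun x hx => ⟨hconv hx, ?_⟩⟩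
  · refine le_antisymm ?_ (hdist _ (hT i hzA) (hT _ (hT i hzA)))
    have h := hcontr i z hzA _ (hT i hzA)
    rw [hzTz] at h
    linarith
  · have hw' (n : ℕ) : T^[n * p] w = w := by
      rw [mul_comm, Function.iterate_mul]
      exact Function.iterate_fixed hwfix n
    have h := hconv hw
    simp only [hw'] at h
    exact tendsto_nhds_unique tendsto_const_nhds h
  · simpa only [Function.iterate_succ_apply] using hconv' hx
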